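/- Let W ∈ ℝ^{m×n}, let B ∈ ℝ^{n×l} be such that BBᵀ is invertible, let k ∈ ℕ, and let L_B ∈ ℝ^{n×n} be any invertible matrix satisfying BBᵀ = L_B L_Bᵀ. Then W'* := SVD_k(W L_B) · L_B^{-1} satisfies rank(W'*) ≤ k and minimizes ‖W B − W' B‖_F² over all W' ∈ ℝ^{m×n} with rank(W') ≤ k. -/

import Mathlib

open Matrix

noncomputable section

/-- The squared Frobenius norm of a real matrix. -/
def frobSq {m n : ℕ} (M : Matrix (Fin m) (Fin n) ℝ) : ℝ := ∑ i, ∑ j, (M i j) ^ 2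

/-- The m×n rectangular diagonal matrix whose (i,i) entry (0-based) is `s (i+1)`,
so that `s` gives the 1-indexed diagonal values `s 1, s 2, …`. -/
def rectDiag (m n : ℕ) (s : ℕ → ℝ) : Matrix (Fin m) (Fin n) ℝ :=
  Matrix.of fun i j => if (i : ℕ) = (j : ℕ) then s ((i : ℕ) + 1) else 0

/-- `IsSVD m n W U s V` says that `W = U Σ Vᵀ` is a singular value decomposition of `W`:
`U` and `V` are orthogonal and `s 1 ≥ s 2 ≥ ⋯ ≥ 0` are the (1-indexed) singular values
of `W` arranged in nonincreasing order along the rectangular diagonal `Σ`. -/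
structure IsSVD (m n : ℕ) (W : Matrix (Fin m) (Fin n) ℝ)
    (U : Matrix (Fin m) (Fin m) ℝ) (s : ℕ → ℝ) (V : Matrix (Fin n) (Fin n) ℝ) : Prop where
  orthU : Uᵀ * U = 1
  orthV : Vᵀ * V = 1
  nonneg : ∀ i, 0 ≤ s i
  mono : ∀ i j, i ≤ j → s j ≤ s i
  decomp : W = U * rectDiag m n s * Vᵀ

/-- The rank-`k` truncation `U Σₖ Vᵀ` of a singular value decomposition,
retaining only the top-`k` singular values `s 1, …, s k`. -/
def svdTrunc (m n k : ℕ) (U : Matrix (Fin m) (Fin m) ℝ) (s : ℕ → ℝ)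
    (V : Matrix (Fin n) (Fin n) ℝ) : Matrix (Fin m) (Fin n) ℝ :=
  U * rectDiag m n (fun i => if i ≤ k then s i else 0) * Vᵀ

theorem frobSq_eq_trace {m n : ℕ} (M : Matrix (Fin m) (Fin n) ℝ) :
    frobSq M = (M * Mᵀ).trace := by
  simp [frobSq, Matrix.trace, Matrix.mul_apply, pow_two]

theorem frobSq_eq_trace_transpose_mul {m n : ℕ} (M : Matrix (Fin m) (Fin n) ℝ) :
    frobSq M = (Mᵀ * M).trace := by
  rw [frobSq_eq_trace, Matrix.trace_mul_comm]

theorem frobSq_nonneg {m n : ℕ} (M : Matrix (Fin m) (Fin n) ℝ) : 0 ≤ frobSq M :=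
  Finset.sum_nonneg fun _ _ => Finset.sum_nonneg fun _ _ => sq_nonneg _

/-- The Frobenius norm of `M * B` depends on `B` only through `B * Bᵀ`. -/
theorem frobSq_mul_congr {m n l p : ℕ} (M : Matrix (Fin m) (Fin n) ℝ)
    {B : Matrix (Fin n) (Fin l) ℝ} {L : Matrix (Fin n) (Fin p) ℝ} (h : B * Bᵀ = L * Lᵀ) :
    frobSq (M * B) = frobSq (M * L) := by
  have key : ∀ {q : ℕ} (C : Matrix (Fin n) (Fin q) ℝ),
      frobSq (M * C) = (M * (C * Cᵀ) * Mᵀ).trace := by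
    intro q C
    rw [frobSq_eq_trace, Matrix.transpose_mul]
    simp only [Matrix.mul_assoc]
  rw [key, key, h]

theorem frobSq_mul_orthogonal {m n : ℕ} (M : Matrix (Fin m) (Fin n) ℝ)
    {V : Matrix (Fin n) (Fin n) ℝ} (hV : V * Vᵀ = 1) : frobSq (M * V) = frobSq M := by
  rw [frobSq_mul_congr M (L := 1) (by rw [hV, Matrix.transpose_one, Matrix.mul_one]),
    Matrix.mul_one]

theorem frobSq_isometry_mul {m n p : ℕ} (M : Matrix (Fin m) (Fin n) ℝ)
    {U : Matrix (Fin p) (Fin m) ℝ} (hU : Uᵀ * U = 1) : frobSq (U * M) = frobSq M := by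
  rw [frobSq_eq_trace_transpose_mul, frobSq_eq_trace_transpose_mul, Matrix.transpose_mul,
    Matrix.mul_assoc, ← Matrix.mul_assoc Uᵀ, hU, Matrix.one_mul]

/-- Pythagoras for the orthogonal projection `Q * Qᵀ` onto the span of orthonormal columns. -/
theorem frobSq_eq_add_frobSq_sub {m n r : ℕ} {Q : Matrix (Fin m) (Fin r) ℝ} (hQ : Qᵀ * Q = 1)
    (E : Matrix (Fin m) (Fin n) ℝ) :
    frobSq E = frobSq (Qᵀ * E) + frobSq (E - Q * (Qᵀ * E)) := by
  have h : (E - Q * (Qᵀ * E))ᵀ * (E - Q * (Qᵀ * E)) = Eᵀ * E - (Qᵀ * E)ᵀ * (Qᵀ * E) := by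
    have h' : Qᵀ * (E - Q * (Qᵀ * E)) = 0 := by
      rw [Matrix.mul_sub, ← Matrix.mul_assoc, hQ, Matrix.one_mul, sub_self]
    rw [Matrix.transpose_sub, Matrix.transpose_mul Q, Matrix.sub_mul, Matrix.mul_assoc _ Qᵀ, h',
      Matrix.mul_zero, sub_zero, Matrix.mul_sub, Matrix.transpose_mul Qᵀ,
      Matrix.transpose_transpose, Matrix.mul_assoc]
  simp only [frobSq_eq_trace_transpose_mul]
  rw [h, Matrix.trace_sub]
  ring

/-- The column space of a matrix has an orthonormal basis. -/
theorem exists_orthonormal_columns {m n : ℕ} (Y : Matrix (Fin m) (Fin n) ℝ) :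
    ∃ Q : Matrix (Fin m) (Fin Y.rank) ℝ, Qᵀ * Q = 1 ∧ Q * (Qᵀ * Y) = Y := by
  let K := LinearMap.range (Matrix.toEuclideanLin Y)
  have hK : Module.finrank ℝ K = Y.rank := by
    rw [Matrix.rank_eq_finrank_range_toLin Y (PiLp.basisFun 2 ℝ (Fin m))
      (PiLp.basisFun 2 ℝ (Fin n))]
    rfl
  obtain ⟨b⟩ : Nonempty (OrthonormalBasis (Fin Y.rank) ℝ K) :=
    ⟨(stdOrthonormalBasis ℝ K).reindex (finCongr hK)⟩
  refine ⟨Matrix.of fun i c => (b c : EuclideanSpace ℝ (Fin m)) i, ?_, ?_⟩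
  · ext c d
    have h := orthonormal_iff_ite.mp b.orthonormal c d
    rw [Submodule.coe_inner, PiLp.inner_apply] at h
    rw [Matrix.mul_apply, Matrix.one_apply, ← h]
    refine Finset.sum_congr rfl fun i _ => ?_
    rw [RCLike.inner_apply, conj_trivial, mul_comm]
    rfl
  · ext i j
    let y : K := ⟨Matrix.toEuclideanLin Y (EuclideanSpace.single j 1), LinearMap.mem_range_self _ _⟩
    have hy : ∀ i, (y : EuclideanSpace ℝ (Fin m)) i = Y i j := by
      intro i
      simp [y, Matrix.toEuclideanLin]
    have hinner : ∀ c, inner ℝ (b c) y = ∑ x, (b c : EuclideanSpace ℝ (Fin m)) x * Y x j := by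
      intro c
      rw [Submodule.coe_inner, PiLp.inner_apply]
      exact Finset.sum_congr rfl fun x _ => by
        rw [hy, RCLike.inner_apply, conj_trivial, mul_comm]
    have h := congrArg (fun z : K => (z : EuclideanSpace ℝ (Fin m)) i) (b.sum_repr' y)
    simp only [hinner, Submodule.coe_sum, Submodule.coe_smul, WithLp.ofLp_sum, WithLp.ofLp_smul,
      Finset.sum_apply, Pi.smul_apply, smul_eq_mul, hy] at h
    rw [← h, Matrix.mul_apply]
    refine Finset.sum_congr rfl fun c _ => ?_
    rw [Matrix.mul_apply, mul_comm]
    rfl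

theorem rectDiag_mul_transpose (m n : ℕ) (s : ℕ → ℝ) :
    rectDiag m n s * (rectDiag m n s)ᵀ =
      Matrix.diagonal fun i : Fin m => if (i : ℕ) < n then s (i + 1) ^ 2 else 0 := by
  ext i i'
  simp only [Matrix.mul_apply, rectDiag, Matrix.transpose_apply, Matrix.of_apply,
    Matrix.diagonal_apply]
  by_cases hi : (i : ℕ) < n
  · rw [Finset.sum_eq_single (⟨i, hi⟩ : Fin n)]
    · by_cases h : i = i'
      · subst h
        simp [hi, pow_two]
      · have : (i' : ℕ) ≠ i := fun e => h (Fin.ext e.symm)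
        simp [h, this]
    · intro j _ hj
      rw [if_neg fun e => hj (Fin.ext e.symm), zero_mul]
    · simp
  · rw [Finset.sum_eq_zero]
    · simp [hi]
    · intro j _
      rw [if_neg (by omega), zero_mul]

theorem rank_rectDiag_trunc_le (m n k : ℕ) (s : ℕ → ℝ) :
    (rectDiag m n fun i => if i ≤ k then s i else 0).rank ≤ k := by
  have h : (rectDiag m n fun i => if i ≤ k then s i else 0) =
      (Matrix.of fun (i : Fin m) (c : Fin k) => if (i : ℕ) = c then (1 : ℝ) else 0) *
        rectDiag k n s := by
    ext i j
    simp only [rectDiag, Matrix.mul_apply, Matrix.of_apply, ite_mul, one_mul, zero_mul]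
    by_cases hi : (i : ℕ) < k
    · rw [Finset.sum_eq_single (⟨i, hi⟩ : Fin k)]
      · simp [hi]
      · intro c _ hc
        rw [if_neg fun e => hc (Fin.ext e.symm)]
      · simp
    · rw [Finset.sum_eq_zero]
      · simp [hi]
      · intro c _
        rw [if_neg (by omega)]
  rw [h]
  exact (Matrix.rank_mul_le_left _ _).trans (Matrix.rank_le_width _)

/-- A weighted sum of an antitone sequence with weights in `[0, 1]` of total mass at most `k`
is at most the sum of its first `k` terms. -/
theorem sum_mul_le_sum_first {m k : ℕ} {a : ℕ → ℝ} (ha : Antitone a) (ha0 : ∀ i, 0 ≤ a i)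
    {p : Fin m → ℝ} (hp0 : ∀ i, 0 ≤ p i) (hp1 : ∀ i, p i ≤ 1) (hp : ∑ i, p i ≤ k) :
    ∑ i, p i * a i ≤ ∑ i : Fin m, if (i : ℕ) < k then a i else 0 := by
  rcases le_total m k with hmk | hmk
  · refine Finset.sum_le_sum fun i _ => ?_
    rw [if_pos (i.2.trans_le hmk)]
    exact mul_le_of_le_one_left (ha0 _) (hp1 i)
  · have hcard : ∑ i : Fin m, (if (i : ℕ) < k then (1 : ℝ) else 0) = k := by
      rw [Fin.sum_univ_eq_sum_range fun i => if i < k then (1 : ℝ) else 0]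
      rw [← Finset.sum_filter, Finset.sum_const, nsmul_one]
      congr 1
      rw [show (Finset.range m).filter (· < k) = Finset.range k by
        ext i; simp only [Finset.mem_filter, Finset.mem_range]; omega, Finset.card_range]
    have hterm : ∀ i : Fin m, p i * a i ≤
        (if (i : ℕ) < k then a i else 0) + a k * (p i - if (i : ℕ) < k then 1 else 0) := by
      intro i
      split_ifs with hi
      · nlinarith [mul_nonneg (sub_nonneg.2 (hp1 i)) (sub_nonneg.2 (ha hi.le))]
      · nlinarith [mul_nonneg (hp0 i) (sub_nonneg.2 (ha (not_lt.1 hi)))]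
    refine (Finset.sum_le_sum fun i _ => hterm i).trans ?_
    rw [Finset.sum_add_distrib, ← Finset.mul_sum, Finset.sum_sub_distrib, hcard]
    nlinarith [mul_nonneg (ha0 k) (sub_nonneg.2 hp)]

/-- The Eckart–Young inequality for rectangular diagonal matrices. -/
theorem frobSq_rectDiag_sub_trunc_le {m n k : ℕ} {s : ℕ → ℝ} (hs0 : ∀ i, 0 ≤ s i)
    (hs : Antitone s) (Y : Matrix (Fin m) (Fin n) ℝ) (hY : Y.rank ≤ k) :
    frobSq (rectDiag m n s - rectDiag m n fun i => if i ≤ k then s i else 0) ≤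
      frobSq (rectDiag m n s - Y) := by
  set D := rectDiag m n s with hD
  set a : ℕ → ℝ := fun i => if i < n then s (i + 1) ^ 2 else 0 with ha_def
  have ha0 : ∀ i, 0 ≤ a i := fun i => by
    simp only [ha_def]
    split_ifs <;> positivity
  have ha : Antitone a := by
    intro i j hij
    simp only [ha_def]
    split_ifs with h1 h2
    · exact pow_le_pow_left₀ (hs0 _) (hs (by omega)) 2
    · omega
    · positivity
    · exact le_rfl
  obtain ⟨Q, hQ, hQY⟩ := exists_orthonormal_columns Y
  have hDD : D * Dᵀ = Matrix.diagonal fun i : Fin m => a i := rectDiag_mul_transpose m n s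
  have hfD : frobSq D = ∑ i : Fin m, a i := by
    rw [frobSq_eq_trace, hDD, Matrix.trace_diagonal]
  have hfQD : frobSq (Qᵀ * D) = ∑ i, (Q * Qᵀ) i i * a i := by
    rw [frobSq_eq_trace, Matrix.transpose_mul, Matrix.transpose_transpose, Matrix.mul_assoc,
      ← Matrix.mul_assoc D, hDD, Matrix.trace_mul_comm, Matrix.mul_assoc, Matrix.trace_mul_comm]
    simp [Matrix.trace, Matrix.mul_diagonal]
  have hp0 : ∀ i, 0 ≤ (Q * Qᵀ) i i := fun i => by
    simp only [Matrix.mul_apply, Matrix.transpose_apply]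
    exact Finset.sum_nonneg fun _ _ => mul_self_nonneg _
  have hp1 : ∀ i, (Q * Qᵀ) i i ≤ 1 := by
    intro i
    have hidem : (Q * Qᵀ) * (Q * Qᵀ)ᵀ = Q * Qᵀ := by
      rw [Matrix.transpose_mul, Matrix.transpose_transpose, Matrix.mul_assoc,
        ← Matrix.mul_assoc Qᵀ, hQ, Matrix.one_mul]
    have h := congrFun (congrFun hidem i) i
    rw [Matrix.mul_apply] at h
    have h' := Finset.single_le_sum (f := fun j => (Q * Qᵀ) i j * (Q * Qᵀ)ᵀ j i)
      (fun j _ => mul_self_nonneg _) (Finset.mem_univ i)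
    rw [h] at h'
    simp only [Matrix.transpose_apply] at h'
    nlinarith
  have hp : ∑ i, (Q * Qᵀ) i i ≤ k := by
    have h : (Q * Qᵀ).trace = Y.rank := by
      rw [Matrix.trace_mul_comm, hQ, Matrix.trace_one, Fintype.card_fin]
    calc ∑ i, (Q * Qᵀ) i i = Y.rank := h
      _ ≤ k := by exact_mod_cast hY
  have hweights := sum_mul_le_sum_first ha ha0 hp0 hp1 hp
  have hpythD := frobSq_eq_add_frobSq_sub hQ D
  have hpythE := frobSq_eq_add_frobSq_sub hQ (D - Y)
  have hproj : D - Y - Q * (Qᵀ * (D - Y)) = D - Q * (Qᵀ * D) := by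
    rw [Matrix.mul_sub, Matrix.mul_sub, hQY]
    abel
  rw [hproj] at hpythE
  have htail : frobSq (D - rectDiag m n fun i => if i ≤ k then s i else 0) =
      ∑ i : Fin m, a i - ∑ i : Fin m, if (i : ℕ) < k then a i else 0 := by
    have h : (D - rectDiag m n fun i => if i ≤ k then s i else 0) =
        rectDiag m n fun i => if i ≤ k then 0 else s i := by
      ext i j
      simp only [hD, rectDiag, Matrix.sub_apply, Matrix.of_apply]
      split_ifs <;> simp
    rw [h, frobSq_eq_trace, rectDiag_mul_transpose, Matrix.trace_diagonal,
      ← Finset.sum_sub_distrib]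
    refine Finset.sum_congr rfl fun i _ => ?_
    simp only [ha_def, Nat.succ_le_iff]
    split_ifs <;> simp
  have := frobSq_nonneg (Qᵀ * (D - Y))
  linarith

/-- The Eckart–Young inequality in the Frobenius norm. -/
theorem IsSVD.frobSq_sub_svdTrunc_le {m n k : ℕ} {A : Matrix (Fin m) (Fin n) ℝ}
    {U : Matrix (Fin m) (Fin m) ℝ} {s : ℕ → ℝ} {V : Matrix (Fin n) (Fin n) ℝ}
    (h : IsSVD m n A U s V) (X : Matrix (Fin m) (Fin n) ℝ) (hX : X.rank ≤ k) :
    frobSq (A - svdTrunc m n k U s V) ≤ frobSq (A - X) := by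
  have hU : U * Uᵀ = 1 := mul_eq_one_comm.mp h.orthU
  have hV : V * Vᵀ = 1 := mul_eq_one_comm.mp h.orthV
  have hinv : ∀ E : Matrix (Fin m) (Fin n) ℝ, frobSq (U * E * Vᵀ) = frobSq E := fun E => by
    rw [frobSq_mul_orthogonal _ (by simpa using h.orthV), frobSq_isometry_mul _ h.orthU]
  have hXeq : X = U * (Uᵀ * X * V) * Vᵀ := by
    rw [← Matrix.mul_assoc, ← Matrix.mul_assoc, hU, Matrix.one_mul, Matrix.mul_assoc, hV,
      Matrix.mul_one]
  have hrank : (Uᵀ * X * V).rank ≤ k :=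
    (Matrix.rank_mul_le_left _ _).trans ((Matrix.rank_mul_le_right _ _).trans hX)
  rw [hXeq, h.decomp, svdTrunc, ← Matrix.sub_mul, ← Matrix.mul_sub, ← Matrix.sub_mul,
    ← Matrix.mul_sub, hinv, hinv]
  exact frobSq_rectDiag_sub_trunc_le h.nonneg (fun i j => h.mono i j) _ hrank

theorem rank_svdTrunc_le (m n k : ℕ) (U : Matrix (Fin m) (Fin m) ℝ) (s : ℕ → ℝ)
    (V : Matrix (Fin n) (Fin n) ℝ) : (svdTrunc m n k U s V).rank ≤ k :=
  (Matrix.rank_mul_le_left _ _).trans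
    ((Matrix.rank_mul_le_right _ _).trans (rank_rectDiag_trunc_le m n k s))

/-- No distribution shift (`A = B`): with `B Bᵀ` invertible and `B Bᵀ = L Lᵀ` for an
invertible `L`, the matrix `W'* = SVD_k(W L) L⁻¹` has rank at most `k` and minimizes
`‖W B − W' B‖_F²` over all `W'` of rank at most `k`. -/
theorem whitening_lowrank_solution {m n l k : ℕ}
    (W : Matrix (Fin m) (Fin n) ℝ) (B : Matrix (Fin n) (Fin l) ℝ)
    (hBB : IsUnit (B * Bᵀ).det)
    (L : Matrix (Fin n) (Fin n) ℝ) (hL : IsUnit L.det) (hfac : B * Bᵀ = L * Lᵀ)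
    (U : Matrix (Fin m) (Fin m) ℝ) (s : ℕ → ℝ) (V : Matrix (Fin n) (Fin n) ℝ)
    (hSVD : IsSVD m n (W * L) U s V) :
    (svdTrunc m n k U s V * L⁻¹).rank ≤ k ∧
    ∀ W' : Matrix (Fin m) (Fin n) ℝ, W'.rank ≤ k →
      frobSq (W * B - (svdTrunc m n k U s V * L⁻¹) * B) ≤ frobSq (W * B - W' * B) := by
  refine ⟨(Matrix.rank_mul_le_left _ _).trans (rank_svdTrunc_le m n k U s V), fun W' hW' => ?_⟩
  rw [← Matrix.sub_mul, ← Matrix.sub_mul, frobSq_mul_congr _ hfac, frobSq_mul_congr _ hfac,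
    Matrix.sub_mul, Matrix.sub_mul, Matrix.mul_assoc _ L⁻¹, Matrix.nonsing_inv_mul _ hL,
    Matrix.mul_one]
  exact hSVD.frobSq_sub_svdTrunc_le _ ((Matrix.rank_mul_le_left _ _).trans hW')
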